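/- Among all 3×3 boards not equivalent to the standard board S, the board [(1 3)] maximizes the number of three-letter words shared with S: for every bijection B : Fin 3 × Fin 3 → Fin 9 that is not equivalent to S, the cardinality of W₃(B) ∩ W₃(S) is at most 136. -/

import Mathlib

/-- King-move adjacency on the cells of a 3×3 grid: two cells are adjacent if they are
distinct and their coordinates differ by at most 1 in each component. -/
def cellAdj (a b : Fin 3 × Fin 3) : Prop :=
  a ≠ b ∧ |(a.1.val : ℤ) - (b.1.val : ℤ)| ≤ 1 ∧ |(a.2.val : ℤ) - (b.2.val : ℤ)| ≤ 1

/-- `w` is a word of the board `B`: a list of letters of length at least 2 of the form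
`B c₁, …, B c_k` where the cells `c₁, …, c_k` are pairwise distinct and consecutive
cells are adjacent.  (For a bijective board this says exactly that `w` is a list of
pairwise distinct letters whose consecutive letters occupy adjacent cells.) -/
def IsWordOf {A : Type*} (B : Fin 3 × Fin 3 → A) (w : List A) : Prop :=
  2 ≤ w.length ∧
    ∃ cs : List (Fin 3 × Fin 3), cs.map B = w ∧ cs.Nodup ∧ cs.Chain' cellAdj

/-- The set `W(B)` of all words of the board `B`. -/
def Words {A : Type*} (B : Fin 3 × Fin 3 → A) : Set (List A) :=
  {w | IsWordOf B w}

/-- The set `W_k(B)` of all `k`-letter words of the board `B`. -/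
def WordsOfLen {A : Type*} (B : Fin 3 × Fin 3 → A) (k : ℕ) : Set (List A) :=
  {w | w.length = k ∧ IsWordOf B w}

/-- Rotation of the 3×3 grid by 90 degrees. -/
def rotCell (c : Fin 3 × Fin 3) : Fin 3 × Fin 3 := (c.2, 2 - c.1)

/-- Reflection of the 3×3 grid along the main diagonal. -/
def reflCell (c : Fin 3 × Fin 3) : Fin 3 × Fin 3 := (c.2, c.1)

/-- The symmetry group of the square acting on the 3×3 grid: the eight
rotations and reflections. -/
def squareSymm : Set ((Fin 3 × Fin 3) → (Fin 3 × Fin 3)) :=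
  {id, rotCell, rotCell ∘ rotCell, rotCell ∘ rotCell ∘ rotCell,
   reflCell, reflCell ∘ rotCell, reflCell ∘ rotCell ∘ rotCell,
   reflCell ∘ rotCell ∘ rotCell ∘ rotCell}

/-- Two boards are equivalent if one is obtained from the other by a symmetry
of the square. -/
def BoardEquiv {A : Type*} (B B' : Fin 3 × Fin 3 → A) : Prop :=
  ∃ σ ∈ squareSymm, B' = B ∘ σ

/-- The standard board `S`: the border cells, read clockwise from the top-left
corner, carry the letters `0,…,7` and the center cell carries the letter `8`
(letters are 0-indexed, so paper letter `i` is `i - 1 : Fin 9`). -/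
def stdBoard : Fin 3 × Fin 3 → Fin 9 := fun c =>
  ![![(0 : Fin 9), 1, 2], ![7, 8, 3], ![6, 5, 4]] c.1 c.2

/-- The board `[(1 3)]` obtained from the standard board by swapping the two upper
corner letters (paper letters 1 and 3, i.e. `0` and `2 : Fin 9`). -/
def swapBoard : Fin 3 × Fin 3 → Fin 9 :=
  (Equiv.swap (0 : Fin 9) 2) ∘ stdBoard

open Finset

instance : DecidableRel cellAdj := fun a b => by
  unfold cellAdj
  infer_instance

theorem cellAdj_comm (a b : Fin 3 × Fin 3) : cellAdj a b ↔ cellAdj b a := by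
  unfold cellAdj
  rw [ne_comm, abs_sub_comm, abs_sub_comm (a.2.val : ℤ)]

/-! ### Counting common words through common neighbours -/

/-- The cells adjacent to `b` whose images under `π` are adjacent to `π b`. -/
def commonNbrs (π : Fin 3 × Fin 3 → Fin 3 × Fin 3) (b : Fin 3 × Fin 3) :
    Finset (Fin 3 × Fin 3) :=
  {a | cellAdj a b ∧ cellAdj (π a) (π b)}

theorem exists_of_mem_wordsOfLen_three {A : Type*} {B : Fin 3 × Fin 3 → A} {w : List A}
    (hw : w ∈ WordsOfLen B 3) :
    ∃ a b c, w = [B a, B b, B c] ∧ a ≠ c ∧ cellAdj a b ∧ cellAdj c b := by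
  obtain ⟨hlen, -, cs, rfl, hnd, hch⟩ := hw
  rw [List.length_map] at hlen
  obtain ⟨a, b, c, rfl⟩ := List.length_eq_three.1 hlen
  refine ⟨a, b, c, rfl, ?_, ?_, ?_⟩
  · rintro rfl
    simp at hnd
  · change List.IsChain _ _ at hch
    simp only [List.isChain_cons_cons] at hch
    exact hch.1
  · change List.IsChain _ _ at hch
    simp only [List.isChain_cons_cons] at hch
    exact (cellAdj_comm _ _).1 hch.2.1

theorem ncard_common_words_le {A : Type*} {S B : Fin 3 × Fin 3 → A}
    (hS : Function.Injective S) {π : Fin 3 × Fin 3 → Fin 3 × Fin 3} (hπ : ∀ c, S (π c) = B c) :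
    (WordsOfLen B 3 ∩ WordsOfLen S 3).ncard ≤
      ∑ b, #(commonNbrs π b) * (#(commonNbrs π b) - 1) := by
  classical
  have hsub : WordsOfLen B 3 ∩ WordsOfLen S 3 ⊆
      ((univ.biUnion fun b => (commonNbrs π b).offDiag.image
        fun x => [B x.1, B b, B x.2] : Finset (List A)) : Set (List A)) := by
    rintro w ⟨hwB, hwS⟩
    obtain ⟨a, b, c, rfl, hac, hab, hcb⟩ := exists_of_mem_wordsOfLen_three hwB
    obtain ⟨a', b', c', hw, -, hab', hcb'⟩ := exists_of_mem_wordsOfLen_three hwS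
    simp only [← hπ, List.cons.injEq, and_true] at hw
    obtain ⟨ha, hb, hc⟩ := hw
    obtain rfl := hS ha
    obtain rfl := hS hb
    obtain rfl := hS hc
    simp only [coe_biUnion, coe_image, Set.mem_iUnion]
    refine ⟨b, mem_coe.2 (mem_univ _), (a, c), ?_, rfl⟩
    simp [commonNbrs, *]
  calc _ ≤ _ := Set.ncard_le_ncard hsub (finite_toSet _)
    _ = _ := Set.ncard_coe_finset _
    _ ≤ ∑ b, #((commonNbrs π b).offDiag.image fun x => [B x.1, B b, B x.2]) := card_biUnion_le
    _ ≤ _ := sum_le_sum fun b _ => card_image_le.trans <| by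
      rw [offDiag_card, Nat.mul_sub_one]

/-! ### A pruned search over relabellings of the cells -/

/-- An enumeration of the cells: the center, then the edge midpoints, then the corners. -/
def cellEquiv : Fin 9 ≃ Fin 3 × Fin 3 where
  toFun := ![(1, 1), (0, 1), (1, 2), (2, 1), (1, 0), (0, 0), (0, 2), (2, 2), (2, 0)]
  invFun c := ![![5, 1, 6], ![4, 0, 2], ![8, 3, 7]] c.1 c.2
  left_inv := by decide
  right_inv := by decide

/-- Adjacency of cells in terms of their indices under `cellEquiv`, read off from the
adjacency matrix, stored as a bit mask. -/
def idxAdj (i j : ℕ) : Bool := Nat.testBit 0x190681c272bcab2cebfe (9 * i + j)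

theorem idxAdj_iff_cellAdj (i j : Fin 9) :
    idxAdj i j = true ↔ cellAdj (cellEquiv i) (cellEquiv j) := by
  revert i j
  decide +kernel

/-- The pairs of positions `i`, `j` that the partial relabelling `p` either leaves undetermined
or sends to adjacent positions. -/
def compatible (p : List ℕ) (i j : ℕ) : Bool :=
  p[i]?.all fun a => p[j]?.all fun b => idxAdj a b

/-- An upper bound for the number of common neighbours of position `j` in all extensions of the
partial relabelling `p`. -/
def nbrBound (p : List ℕ) (j : ℕ) : ℕ :=
  min #{i ∈ range 9 | idxAdj i j && compatible p i j}
    (p[j]?.elim 8 fun b => #{a ∈ range 9 | idxAdj a b})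

/-- An upper bound for the number of common words in all extensions of `p`. -/
def wordBound (p : List ℕ) : ℕ := ∑ j ∈ range 9, nbrBound p j * (nbrBound p j - 1)

/-- The list of values of a relabelling of the cells. -/
def relabelling (π : Fin 3 × Fin 3 → Fin 3 × Fin 3) : List ℕ :=
  List.ofFn fun i => (cellEquiv.symm (π (cellEquiv i)) : ℕ)

/-- The elements of `squareSymm`. -/
def squareSymmList : List (Fin 3 × Fin 3 → Fin 3 × Fin 3) :=
  [id, rotCell, rotCell ∘ rotCell, rotCell ∘ rotCell ∘ rotCell,
   reflCell, reflCell ∘ rotCell, reflCell ∘ rotCell ∘ rotCell,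
   reflCell ∘ rotCell ∘ rotCell ∘ rotCell]

/-- Checks that each extension of `p` by `n` new values shares at most 136 words or comes from
a symmetry of the square. -/
def search : ℕ → List ℕ → Bool
  | 0, p => decide (wordBound p ≤ 136) || decide (p ∈ squareSymmList.map relabelling)
  | n + 1, p => decide (wordBound p ≤ 136) ||
      (List.range 9).all fun x => decide (x ∈ p) || search n (p ++ [x])

theorem search_nine : search 9 [] = true := by decide +kernel

theorem getElem?_of_take {α : Type*} {q : List α} {k i : ℕ} {a : α}
    (h : (q.take k)[i]? = some a) : q[i]? = some a := by
  rw [List.getElem?_take] at h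
  split_ifs at h
  exact h

theorem compatible_take {q : List ℕ} {k i j : ℕ} (h : compatible q i j) :
    compatible (q.take k) i j := by
  simp only [compatible, Option.all_eq_true] at h ⊢
  exact fun a ha b hb => h a (getElem?_of_take ha) b (getElem?_of_take hb)

theorem card_idxAdj_le (b : ℕ) (hb : b < 9) : #{a ∈ range 9 | idxAdj a b} ≤ 8 := by
  revert b
  decide +kernel

theorem nbrBound_le_take {q : List ℕ} (hq : ∀ x ∈ q, x < 9) (k j : ℕ) :
    nbrBound q j ≤ nbrBound (q.take k) j := by
  refine min_le_min (card_le_card (monotone_filter_right _ fun i _ hi => ?_)) ?_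
  · simp only [Bool.and_eq_true] at hi ⊢
    exact ⟨hi.1, compatible_take hi.2⟩
  · cases h : (q.take k)[j]? with
    | some b => rw [getElem?_of_take h]
    | none =>
      cases h' : q[j]? with
      | none => exact le_rfl
      | some b => exact card_idxAdj_le b (hq b (List.mem_of_getElem? h'))

theorem wordBound_le_take {q : List ℕ} (hq : ∀ x ∈ q, x < 9) (k : ℕ) :
    wordBound q ≤ wordBound (q.take k) :=
  sum_le_sum fun j _ => Nat.mul_le_mul (nbrBound_le_take hq k j)
    (Nat.sub_le_sub_right (nbrBound_le_take hq k j) 1)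

theorem search_take_sound {q : List ℕ} (hlen : q.length = 9) (hq : ∀ x ∈ q, x < 9)
    (hnd : q.Nodup) (n : ℕ) (hn : n ≤ 9) (h : search n (q.take (9 - n)) = true) :
    wordBound q ≤ 136 ∨ q ∈ squareSymmList.map relabelling := by
  induction n with
  | zero =>
    rw [Nat.sub_zero, List.take_of_length_le hlen.le] at h
    simpa only [search, Bool.or_eq_true, decide_eq_true_eq] using h
  | succ n ih =>
    simp only [search, Bool.or_eq_true, decide_eq_true_eq, List.all_eq_true,
      List.mem_range] at h
    rcases h with h | h
    · exact .inl ((wordBound_le_take hq _).trans h)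
    · have hlt : 9 - (n + 1) < q.length := by omega
      have htake : q.take (9 - n) = q.take (9 - (n + 1)) ++ [q[9 - (n + 1)]] := by
        rw [← List.take_succ_eq_append_getElem hlt]
        congr 1
        omega
      refine ih (by omega) ?_
      rw [htake]
      refine (h _ (hq _ (List.getElem_mem hlt))).resolve_left fun hmem => ?_
      have hnd' := hnd.sublist (List.take_sublist (9 - n) q)
      rw [htake, List.nodup_append] at hnd'
      exact hnd'.2.2 _ hmem _ (List.mem_singleton_self _) rfl

/-! ### Interpreting the search -/

theorem relabelling_injective : Function.Injective relabelling := by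
  intro π ρ h
  have h' := List.ofFn_injective h
  funext c
  obtain ⟨i, rfl⟩ := cellEquiv.surjective c
  exact cellEquiv.symm.injective (Fin.val_injective (congrFun h' i))

theorem relabelling_getElem? (π : Fin 3 × Fin 3 → Fin 3 × Fin 3) (i : Fin 9) :
    (relabelling π)[(i : ℕ)]? = some (cellEquiv.symm (π (cellEquiv i)) : ℕ) := by
  rw [relabelling, List.getElem?_ofFn, dif_pos i.is_lt]

theorem card_commonNbrs_le {π : Fin 3 × Fin 3 → Fin 3 × Fin 3} (hπ : Function.Injective π)
    (j : Fin 9) : #(commonNbrs π (cellEquiv j)) ≤ nbrBound (relabelling π) j := by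
  have hadj (a b : Fin 3 × Fin 3) :
      idxAdj (cellEquiv.symm a) (cellEquiv.symm b) = true ↔ cellAdj a b := by
    simp [idxAdj_iff_cellAdj]
  refine le_min ?_ ?_
  · refine card_le_card_of_injOn (fun a => (cellEquiv.symm a : ℕ)) (fun a ha => ?_)
      (Fin.val_injective.comp cellEquiv.symm.injective).injOn
    simp only [commonNbrs, coe_filter, mem_univ, true_and, Set.mem_ofPred_eq] at ha
    simp only [coe_filter, mem_range, Set.mem_ofPred_eq, Fin.is_lt, true_and, Bool.and_eq_true,
      compatible, relabelling_getElem?, Option.all_some, Equiv.apply_symm_apply, hadj]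
    exact ⟨by simpa [← hadj] using ha.1, ha.2⟩
  · rw [relabelling_getElem?]
    refine card_le_card_of_injOn (fun a => (cellEquiv.symm (π a) : ℕ)) (fun a ha => ?_)
      (Fin.val_injective.comp (cellEquiv.symm.injective.comp hπ)).injOn
    simp only [commonNbrs, coe_filter, mem_univ, true_and, Set.mem_ofPred_eq] at ha
    simpa [hadj] using ha.2

theorem sum_commonNbrs_le_wordBound {π : Fin 3 × Fin 3 → Fin 3 × Fin 3}
    (hπ : Function.Injective π) :
    ∑ b, #(commonNbrs π b) * (#(commonNbrs π b) - 1) ≤ wordBound (relabelling π) := by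
  rw [wordBound, ← cellEquiv.sum_comp, ← Fin.sum_univ_eq_sum_range
    (fun j => nbrBound (relabelling π) j * (nbrBound (relabelling π) j - 1))]
  exact sum_le_sum fun j _ => Nat.mul_le_mul (card_commonNbrs_le hπ j)
    (Nat.sub_le_sub_right (card_commonNbrs_le hπ j) 1)

theorem wordBound_le_or_mem_squareSymm {π : Fin 3 × Fin 3 → Fin 3 × Fin 3}
    (hπ : Function.Injective π) : wordBound (relabelling π) ≤ 136 ∨ π ∈ squareSymm := by
  refine (search_take_sound (q := relabelling π) List.length_ofFn ?_ ?_ 9 le_rfl search_nine).imp_right fun h => ?_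
  · simp only [relabelling, List.mem_ofFn]
    rintro _ ⟨i, rfl⟩
    exact Fin.is_lt _
  · exact List.nodup_ofFn.2 <| Fin.val_injective.comp <|
      cellEquiv.symm.injective.comp <| hπ.comp cellEquiv.injective
  · rw [List.mem_map_of_injective relabelling_injective] at h
    simpa only [squareSymmList, squareSymm, List.mem_cons, List.not_mem_nil, or_false,
      Set.mem_insert_iff, Set.mem_singleton_iff] using h

theorem stdBoard_injective : Function.Injective stdBoard := by
  decide

theorem stdBoard_surjective : Function.Surjective stdBoard := by
  decide

/-- Every 3×3 board not equivalent to the standard board shares at most 136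
3-letter words with the standard board. -/
theorem common_words_max (B : Fin 3 × Fin 3 → Fin 9) (hB : Function.Bijective B)
    (hne : ¬ BoardEquiv stdBoard B) :
    (WordsOfLen B 3 ∩ WordsOfLen stdBoard 3).ncard ≤ 136 := by
  choose π hπ using fun c => stdBoard_surjective (B c)
  have hinj : Function.Injective π := fun a b h => hB.1 (by rw [← hπ, ← hπ, h])
  refine (ncard_common_words_le stdBoard_injective hπ).trans
    ((sum_commonNbrs_le_wordBound hinj).trans ?_)
  exact (wordBound_le_or_mem_squareSymm hinj).resolve_right fun h =>
    hne ⟨π, h, funext fun c => (hπ c).symm⟩
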